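/- Let P be a submonoid of a group G. For all p, q ∈ P, the operator V_p V_p* V_q V_q* on ℓ²(P) is nonzero if and only if pP ∩ qP ≠ ∅. -/

import Mathlib

noncomputable section

open ContinuousLinearMap
open scoped Classical

variable {G : Type*} [Group G]

/-- The Hilbert space ℓ²(P). -/
abbrev l2 (P : Submonoid G) : Type _ := lp (fun _ : P => ℂ) 2

/-- The standard orthonormal basis vector δ_s of ℓ²(P). -/
def delta (P : Submonoid G) (s : P) : l2 P :=
  letI := Classical.decEq P
  lp.single 2 s 1

/-- The set pX = {px : x ∈ X}. -/
def lmul (P : Submonoid G) (p : P) (X : Set P) : Set P := (fun x => p * x) '' X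

/-- The set p⁻¹X = {y ∈ P : py ∈ X}. -/
def linv (P : Submonoid G) (p : P) (X : Set P) : Set P := {y : P | p * y ∈ X}

/-- The set p₁⁻¹q₁ ⋯ pₙ⁻¹qₙ X, the operations being applied iteratively from the right;
the word is encoded as the list [(p₁,q₁),…,(pₙ,qₙ)]. -/
def wordSet (P : Submonoid G) (l : List (P × P)) (X : Set P) : Set P :=
  l.foldr (fun a Y => linv P a.1 (lmul P a.2 Y)) X

/-- The operator V_{p₁}* V_{q₁} ⋯ V_{pₙ}* V_{qₙ} on ℓ²(P), the word being encoded as the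
list [(p₁,q₁),…,(pₙ,qₙ)]. -/
def opWord (P : Submonoid G) (V : P → (l2 P →L[ℂ] l2 P)) (l : List (P × P)) :
    l2 P →L[ℂ] l2 P :=
  (l.map fun a => (ContinuousLinearMap.adjoint (V a.1)) * (V a.2)).prod

/-- The group element p₁⁻¹q₁ ⋯ pₙ⁻¹qₙ of G. -/
def grpWord (P : Submonoid G) (l : List (P × P)) : G :=
  (l.map fun a => ((a.1 : G))⁻¹ * (a.2 : G)).prod


theorem delta_apply (P : Submonoid G) (s t : P) :
    (delta P s : P → ℂ) t = if t = s then 1 else 0 := by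
  by_cases h : t = s
  · subst h
    simp [delta]
  · simp [delta, h]

theorem inner_delta_left (P : Submonoid G) (s : P) (f : l2 P) :
    inner ℂ (delta P s) f = f s := by
  simp [delta, lp.inner_single_left]

theorem adjoint_apply_coord (P : Submonoid G) {A : l2 P →L[ℂ] l2 P} {s t : P}
    (hA : A (delta P s) = delta P t) (f : l2 P) : (adjoint A f : P → ℂ) s = f t := by
  rw [← inner_delta_left P s, adjoint_inner_right, hA, inner_delta_left]

theorem adjoint_apply_delta_mul (P : Submonoid G) {A : l2 P →L[ℂ] l2 P} {p : P}
    (hA : ∀ s, A (delta P s) = delta P (p * s)) (s : P) :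
    adjoint A (delta P (p * s)) = delta P s := by
  ext t
  rw [adjoint_apply_coord P (hA t), delta_apply, delta_apply]
  simp only [mul_right_inj]

theorem adjoint_apply_delta_of_notMem (P : Submonoid G) {A : l2 P →L[ℂ] l2 P} {p t : P}
    (hA : ∀ s, A (delta P s) = delta P (p * s)) (ht : t ∉ lmul P p Set.univ) :
    adjoint A (delta P t) = 0 := by
  ext s
  rw [adjoint_apply_coord P (hA s), delta_apply, if_neg]
  · rfl
  · exact fun h => ht ⟨s, Set.mem_univ s, h⟩

/-- V_p V_p* V_q V_q* ≠ 0 if and only if pP ∩ qP ≠ ∅. -/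
theorem stmt12 (P : Submonoid G)
    (V : P → (l2 P →L[ℂ] l2 P))
    (hV : ∀ p s : P, V p (delta P s) = delta P (p * s))
    (p q : P) :
    V p * ContinuousLinearMap.adjoint (V p) * V q * ContinuousLinearMap.adjoint (V q) ≠ 0
      ↔ (lmul P p Set.univ ∩ lmul P q Set.univ).Nonempty := by
  constructor
  · contrapose!
    intro h
    have hpq : adjoint (V p) * V q = 0 := by
      ext f s
      rw [mul_apply_eq_comp, adjoint_apply_coord P (hV p s), ← inner_delta_left, ← adjoint_inner_left,
        adjoint_apply_delta_of_notMem P (hV q), inner_zero_left]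
      · rfl
      · intro hq
        exact (Set.eq_empty_iff_forall_notMem.mp h) _ ⟨⟨s, Set.mem_univ s, rfl⟩, hq⟩
    rw [mul_assoc (V p), hpq, mul_zero, zero_mul]
  · rintro ⟨t, ⟨x, -, hx⟩, ⟨y, -, hy⟩⟩ h
    have hx : p * x = t := hx
    have hy : q * y = t := hy
    have ht : delta P t = 0 := by
      have := DFunLike.congr_fun h (delta P t)
      simp only [mul_apply_eq_comp] at this
      rw [← hy, adjoint_apply_delta_mul P (hV q), hV, hy, ← hx,
        adjoint_apply_delta_mul P (hV p), hV, hx] at this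
      exact this
    have h1 := delta_apply P t t
    rw [ht, if_pos rfl] at h1
    exact zero_ne_one h1
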